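/- For every n×n complex matrix M and every ε > 0, each connected component of the ε-pseudospectrum σ_ε(M) has nonempty intersection with the spectrum σ(M) (i.e., each connected component of σ_ε(M) contains an eigenvalue of M). -/

import Mathlib

open Matrix

/-- The ℓ² operator norm of a complex matrix, viewed as a bounded operator
on `EuclideanSpace ℂ (Fin n)`. -/
noncomputable def matNorm {n : ℕ} (M : Matrix (Fin n) (Fin n) ℂ) : ℝ :=
  ‖Matrix.toEuclideanCLM (𝕜 := ℂ) (n := Fin n) M‖

/-- The ε-pseudospectrum of a complex matrix:
`σ_ε(M) := σ(M) ∪ {z ∉ σ(M) : ‖(M - z·I)⁻¹‖ > 1/ε}`. -/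
noncomputable def pseudospectrum {n : ℕ} (ε : ℝ) (M : Matrix (Fin n) (Fin n) ℂ) : Set ℂ :=
  spectrum ℂ M ∪ {z | z ∉ spectrum ℂ M ∧ 1 / ε < matNorm ((M - z • 1)⁻¹)}

section BanachAlgebra

variable {A : Type*} [NormedRing A] [NormedAlgebra ℂ A] [CompleteSpace A]

/-- The resolvent is large near the spectrum. -/
theorem inv_norm_resolvent_le_of_mem_spectrum {a : A} {z w : ℂ} (hz : z ∈ spectrum ℂ a)
    (hw : w ∉ spectrum ℂ a) : ‖resolvent a w‖⁻¹ ≤ ‖z - w‖ * ‖(1 : A)‖ := by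
  by_contra! h
  have hu := spectrum.notMem_iff.1 hw
  refine hz (Units.ofNearby hu.unit (algebraMap ℂ A z - a) ?_).isUnit
  rw [resolvent, ← hu.unit_spec, Ring.inverse_unit] at h
  rwa [hu.unit_spec, sub_sub_sub_cancel_right, ← map_sub, norm_algebraMap]

/-- The `ε`-pseudospectrum of an element of a complex Banach algebra. -/
def algebraPseudospectrum (ε : ℝ) (a : A) : Set ℂ :=
  spectrum ℂ a ∪ {z | z ∉ spectrum ℂ a ∧ 1 / ε < ‖resolvent a z‖}

theorem isOpen_algebraPseudospectrum [NormOneClass A] {ε : ℝ} (hε : 0 < ε) (a : A) :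
    IsOpen (algebraPseudospectrum ε a) := by
  rw [isOpen_iff_mem_nhds]
  rintro z (hz | ⟨hz, hlt⟩)
  · filter_upwards [Metric.ball_mem_nhds z hε] with w hw
    by_cases hwσ : w ∈ spectrum ℂ a
    · exact Or.inl hwσ
    have : Nontrivial A := NormOneClass.nontrivial
    have hpos : 0 < ‖resolvent a w‖ :=
      norm_pos_iff.2 (spectrum.isUnit_resolvent.1 (spectrum.notMem_iff.1 hwσ)).ne_zero
    have hle := inv_norm_resolvent_le_of_mem_spectrum hz hwσ
    rw [norm_one, mul_one, ← dist_eq_norm, dist_comm] at hle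
    exact Or.inr ⟨hwσ, (one_div_lt hε hpos).2 (one_div ‖resolvent a w‖ ▸ hle.trans_lt hw)⟩
  · filter_upwards [(spectrum.isClosed a).isOpen_compl.mem_nhds hz,
      (spectrum.hasDerivAt_resolvent_const_left
        (spectrum.notMem_iff.1 hz)).continuousAt.norm.eventually_const_lt hlt] with w hw hw'
    exact Or.inr ⟨hw, hw'⟩

/-- The resolvent is bounded by `1 / ε` on the frontier of a component, so the maximum modulus
principle excludes a component on which it is analytic. -/
theorem connectedComponentIn_algebraPseudospectrum_inter_spectrum_nonempty [NormOneClass A]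
    {ε : ℝ} (hε : 0 < ε) (a : A) {z : ℂ} (hz : z ∈ algebraPseudospectrum ε a) :
    (connectedComponentIn (algebraPseudospectrum ε a) z ∩ spectrum ℂ a).Nonempty := by
  by_contra! hdisj
  set S := algebraPseudospectrum ε a with hS
  set C := connectedComponentIn S z with hC
  have hSo : IsOpen S := isOpen_algebraPseudospectrum hε a
  have hCo : IsOpen C := hSo.connectedComponentIn
  have hCS : C ⊆ S := connectedComponentIn_subset S z
  have hzC : z ∈ C := mem_connectedComponentIn hz
  have hCr : ∀ w ∈ C, w ∉ spectrum ℂ a ∧ 1 / ε < ‖resolvent a w‖ := fun w hw =>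
    (hCS hw).resolve_left fun h => Set.notMem_empty w (hdisj ▸ ⟨hw, h⟩)
  have hfr : ∀ w ∈ frontier C, w ∉ S := by
    intro w hw hwS
    obtain ⟨y, hyw, hyC⟩ := mem_closure_iff.1 hw.1 _ hSo.connectedComponentIn
      (mem_connectedComponentIn hwS)
    have : C = connectedComponentIn S w :=
      (connectedComponentIn_eq hyC).trans (connectedComponentIn_eq hyw).symm
    exact hw.2 (hCo.interior_eq.symm ▸ this ▸ mem_connectedComponentIn hwS)
  have hbdd : Bornology.IsBounded C := by
    rw [Bornology.isBounded_def]
    have hlim := (spectrum.resolvent_tendsto_cobounded (𝕜 := ℂ) a).norm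
    rw [norm_zero] at hlim
    filter_upwards [hlim.eventually_lt_const (one_div_pos.2 hε)] with w hw hwC
    exact hw.not_gt (hCr w hwC).2
  have hd : DiffContOnCl ℂ (resolvent a) C := by
    refine DifferentiableOn.diffContOnCl fun w hw => ?_
    have hwσ : w ∉ spectrum ℂ a := by
      rw [closure_eq_self_union_frontier] at hw
      exact hw.elim (fun h => (hCr w h).1) fun h hσ => hfr w h (Or.inl hσ)
    exact (spectrum.hasDerivAt_resolvent_const_left
      (spectrum.notMem_iff.1 hwσ)).differentiableAt.differentiableWithinAt
  refine (hCr z hzC).2.not_ge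
    (Complex.norm_le_of_forall_mem_frontier_norm_le hbdd hd (fun w hw => ?_) (subset_closure hzC))
  by_contra! h
  exact hfr w hw (or_iff_not_imp_left.2 fun hσ => ⟨hσ, h⟩)

end BanachAlgebra

theorem matNorm_inv_sub_smul_one {n : ℕ} {M : Matrix (Fin n) (Fin n) ℂ} {z : ℂ}
    (hz : z ∉ spectrum ℂ M) :
    matNorm ((M - z • 1)⁻¹) =
      ‖resolvent (Matrix.toEuclideanCLM (𝕜 := ℂ) (n := Fin n) M) z‖ := by
  set e := Matrix.toEuclideanCLM (𝕜 := ℂ) (n := Fin n)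
  have hu : IsUnit (algebraMap ℂ _ z - M) := spectrum.notMem_iff.1 hz
  have hneg : M - z • 1 = -(algebraMap ℂ _ z - M) := by
    rw [Algebra.algebraMap_eq_smul_one, neg_sub]
  have he : algebraMap ℂ _ z - e M = e (algebraMap ℂ _ z - M) := by
    rw [map_sub, Algebra.algebraMap_eq_smul_one, Algebra.algebraMap_eq_smul_one, map_smul, map_one]
  have hinv : (M - z • 1)⁻¹ * (M - z • 1) = 1 :=
    Matrix.nonsing_inv_mul _ ((Matrix.isUnit_iff_isUnit_det _).1 (hneg ▸ hu.neg))
  have hres : -e (M - z • 1)⁻¹ = resolvent (e M) z := by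
    rw [resolvent, he]
    refine left_inv_eq_right_inv (a := e (algebraMap ℂ _ z - M)) ?_
      (Ring.mul_inverse_cancel _ (hu.map e))
    rw [← map_neg, ← map_mul, neg_mul_comm, ← hneg, hinv, map_one]
  rw [matNorm, ← hres, norm_neg]

theorem pseudospectrum_eq_algebraPseudospectrum {n : ℕ} (ε : ℝ)
    (M : Matrix (Fin n) (Fin n) ℂ) :
    pseudospectrum ε M =
      algebraPseudospectrum ε (Matrix.toEuclideanCLM (𝕜 := ℂ) (n := Fin n) M) := by
  ext z
  simp only [pseudospectrum, algebraPseudospectrum, AlgEquiv.spectrum_eq, Set.mem_union,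
    Set.mem_ofPred_eq]
  refine or_congr_right (and_congr_right fun hz => ?_)
  rw [matNorm_inv_sub_smul_one hz]

/-- Each connected component of the ε-pseudospectrum `σ_ε(M)` has nonempty
intersection with the spectrum `σ(M)`. -/
theorem connectedComponent_pseudospectrum_inter_spectrum_nonempty {n : ℕ}
    (M : Matrix (Fin n) (Fin n) ℂ) (ε : ℝ) (hε : 0 < ε)
    (z : ℂ) (hz : z ∈ pseudospectrum ε M) :
    (connectedComponentIn (pseudospectrum ε M) z ∩ spectrum ℂ M).Nonempty := by
  rw [pseudospectrum_eq_algebraPseudospectrum] at hz ⊢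
  rw [← AlgEquiv.spectrum_eq (Matrix.toEuclideanCLM (𝕜 := ℂ) (n := Fin n)) M]
  rcases n.eq_zero_or_pos with rfl | hn
  · have : Subsingleton (EuclideanSpace ℂ (Fin 0) →L[ℂ] EuclideanSpace ℂ (Fin 0)) := inferInstance
    rcases hz with hz | ⟨-, hz⟩
    · simp [spectrum.of_subsingleton] at hz
    · rw [Subsingleton.elim (resolvent _ z) 0, norm_zero] at hz
      exact absurd hz (one_div_pos.2 hε).not_gt
  · have : NeZero n := ⟨hn.ne'⟩
    exact connectedComponentIn_algebraPseudospectrum_inter_spectrum_nonempty hε _ hz
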